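/- arXiv:2508.14612 — 3 statements merged into one kernel-verified Lean document; each statement's English description precedes it below -/
import Mathlib

section
/- If γ₁, γ₂, …, γ_l are 3-terms of (R₇, ℤ×R₇) having the same degree n that are simultaneously f-connected and g-connected, then l ≥ 16. -/
namespace QHom

variable {X S : Type*}

/-- Generating tuples: an element of `S` together with a list of quandle elements
whose consecutive entries are distinct. -/
abbrev Gen (X S : Type*) := {p : S × List X // p.2.Chain' (· ≠ ·)}

/-- The chain group: the free abelian group on `Gen X S`. -/
abbrev Ch (X S : Type*) := Gen X S →₀ ℤ

/-- The basis chain associated to a tuple; `0` if two consecutive entries coincide. -/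
noncomputable def gen (s : S) (l : List X) : Ch X S := by
  classical
  exact if h : l.Chain' (· ≠ ·) then Finsupp.single ⟨(s, l), h⟩ 1 else 0

noncomputable def fOn (t : Gen X S) : Ch X S :=
  ∑ j : Fin t.1.2.length, ((-1 : ℤ) ^ ((j : ℕ) + 1)) • gen t.1.1 (t.1.2.eraseIdx (j : ℕ))

/-- The map `f`. -/
noncomputable def fmap (γ : Ch X S) : Ch X S := γ.sum fun t c => c • fOn t

noncomputable def gOn (op : X → X → X) (sact : S → X → S) (t : Gen X S) : Ch X S :=
  ∑ j : Fin t.1.2.length,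
    ((-1 : ℤ) ^ (j : ℕ)) •
      gen (sact t.1.1 (t.1.2.get j))
        ((t.1.2.take (j : ℕ)).map (fun x => op x (t.1.2.get j)) ++ t.1.2.drop ((j : ℕ) + 1))

/-- The map `g`. -/
noncomputable def gmap (op : X → X → X) (sact : S → X → S) (γ : Ch X S) : Ch X S :=
  γ.sum fun t c => c • gOn op sact t

/-- The boundary map `∂ = f + g`. -/
noncomputable def bd (op : X → X → X) (sact : S → X → S) (γ : Ch X S) : Ch X S :=
  fmap γ + gmap op sact γ

/-- `γ` is an `m`-chain: it is supported on tuples of length `m`. -/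
def IsMChain (m : ℕ) (γ : Ch X S) : Prop := ∀ t ∈ γ.support, t.1.2.length = m

/-- The length of a chain: the sum of the absolute values of its coefficients. -/
noncomputable def chainLen (γ : Ch X S) : ℕ := γ.sum fun _ c => c.natAbs

/-- `π` : forget the `S`-coordinate. -/
noncomputable def proj (γ : Ch X S) : Ch X Unit := γ.sum fun t c => c • gen () t.1.2

/-- Evaluation of a cochain (given by its values on generating tuples) on a chain. -/
noncomputable def evalCh {A : Type*} [AddCommGroup A] (θ : List X → A) (δ : Ch X Unit) : A :=
  δ.sum fun t c => c • θ t.1.2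

/-- The action of quandle generators on the `X`-set `ℤ × X`. -/
def zact (op : X → X → X) (s : ℤ × X) (a : X) : ℤ × X := (s.1 + 1, op s.2 a)

/-- `γ` is a 3-term of degree `n` and index `u`. -/
def IsTerm3 (γ : Ch X (ℤ × X)) (n : ℤ) (u : X) : Prop :=
  ∃ ε a b c, (ε = (1 : ℤ) ∨ ε = -1) ∧ a ≠ b ∧ b ≠ c ∧ γ = ε • gen (n, u) [a, b, c]

def Efficient {k : ℕ} (γ : Fin k → Ch X S) : Prop := ∀ i j, i ≠ j → γ i ≠ -γ j

def FConnected {k : ℕ} (γ : Fin k → Ch X S) : Prop :=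
  Efficient γ ∧ (∑ i, fmap (γ i)) = 0 ∧
    ∀ I : Finset (Fin k), I.Nonempty → I ≠ Finset.univ → (∑ i ∈ I, fmap (γ i)) ≠ 0

def GConnected {k : ℕ} (op : X → X → X) (sact : S → X → S) (γ : Fin k → Ch X S) : Prop :=
  Efficient γ ∧ (∑ i, gmap op sact (γ i)) = 0 ∧
    ∀ I : Finset (Fin k), I.Nonempty → I ≠ Finset.univ → (∑ i ∈ I, gmap op sact (γ i)) ≠ 0

/-- `n` is the minimal degree of `γ`. -/
def MinDegree (γ : Ch X (ℤ × X)) (n : ℤ) : Prop :=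
  (∃ t ∈ γ.support, t.1.1.1 = n) ∧ ∀ t ∈ γ.support, n ≤ t.1.1.1

/-- `|T_k(γ)|`: the number of terms (with multiplicity) of `γ` of degree `k`. -/
noncomputable def Tcount (γ : Ch X (ℤ × X)) (k : ℤ) : ℕ :=
  γ.sum fun t c => if t.1.1.1 = k then c.natAbs else 0

def revList (op : X → X → X) : List X → List X
  | [] => []
  | a :: l => l.foldl op a :: revList op l

/-- The reverse of a chain of `(X, ℤ × X)` (a chain of the dual quandle). -/
noncomputable def reverse (op : X → X → X) (γ : Ch X (ℤ × X)) : Ch X (ℤ × X) :=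
  γ.sum fun t c => c • gen (-t.1.1.1, t.1.2.foldl op t.1.1.2) (revList op t.1.2)

/-- The degree-shift automorphism `σ`. -/
noncomputable def sigmaMap (γ : Ch X (ℤ × X)) : Ch X (ℤ × X) :=
  γ.sum fun t c => c • gen (t.1.1.1 + 1, t.1.1.2) t.1.2

/-- `γ` is a 3-term of type `ty` with respect to the operation `op`. -/
def IsTypedTerm (op : X → X → X) (γ : Ch X (ℤ × X)) (ty : ℕ) : Prop :=
  ∃ (ε n : ℤ) (u a b c : X), (ε = 1 ∨ ε = -1) ∧ a ≠ b ∧ b ≠ c ∧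
    γ = ε • gen (n, u) [a, b, c] ∧
    ((ty = 0 ∧ a = c ∧ op a b = c) ∨ (ty = 1 ∧ a = c ∧ op a b ≠ c) ∨
      (ty = 2 ∧ a ≠ c ∧ op a b = c) ∨ (ty = 3 ∧ a ≠ c ∧ op a b ≠ c))

/-- A bigon 3-term `⟨x, y⟩` of degree `n` and index `u`. -/
def IsBigon (n : ℤ) (u x y : X) (δ : Ch X (ℤ × X)) : Prop :=
  δ = gen (n, u) [x, y, x] ∨ δ = gen (n, u) [y, x, y]

/-- The case shapes (A), (B), (C). -/
def Shape (δ : Ch X (ℤ × X)) (n : ℤ) (l : ℕ) : Prop :=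
  (4 ≤ l ∧ l ≤ 7 ∧ Tcount δ n = l) ∨
  (6 ≤ l ∧ l ≤ 7 ∧ Tcount δ n = 2 ∧ Tcount δ (n + 1) = l - 2) ∨
  (6 ≤ l ∧ l ≤ 7 ∧ Tcount δ n = 3 ∧ Tcount δ (n + 1) = l - 3)

/-- A quandle structure on `X`. -/
structure QuandleStr (X : Type*) where
  op : X → X → X
  idem : ∀ a, op a a = a
  bij : ∀ b, Function.Bijective fun a => op a b
  dist : ∀ a b c, op (op a b) c = op (op a c) (op b c)

/-- The dual quandle operation. -/
noncomputable def dualOp (Q : QuandleStr X) : X → X → X :=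
  fun a b => (Equiv.ofBijective (fun x => Q.op x b) (Q.bij b)).symm a

/-- An `X`-set: a set with a right action of the associated group `G(X)`, recorded via its
action of the generators, which is bijective generator-wise and compatible with the
defining relations of `G(X)`. -/
structure QSet (X : Type*) (op : X → X → X) (S : Type*) where
  sact : S → X → S
  bij : ∀ a, Function.Bijective fun s => sact s a
  comm : ∀ s a b, sact (sact s a) b = sact (sact s b) (op a b)

/-- The 7-dihedral quandle operation on `ZMod 7`. -/
def R7op : ZMod 7 → ZMod 7 → ZMod 7 := fun a b => 2 * b - a

def zetaInt (a b c : ℤ) : ℤ := (a - b) * ((b ^ 7 + (2 * c - b) ^ 7 - 2 * c ^ 7) / 7)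

/-- The Mochizuki 3-cocycle on triples. -/
def zetaFun (a b c : ZMod 7) : ZMod 7 := (zetaInt a.val b.val c.val : ℤ)

def zetaL : List (ZMod 7) → ZMod 7
  | [a, b, c] => zetaFun a b c
  | _ => 0

/-- The octahedral quandle operation on `Fin 6`: `octAct a b = σ_b(a)`. -/
def octAct : Fin 6 → Fin 6 → Fin 6 := fun a b =>
  ![![0, 2, 4, 3, 5, 1],
    ![5, 1, 0, 2, 4, 3],
    ![1, 3, 2, 4, 0, 5],
    ![0, 5, 1, 3, 2, 4],
    ![2, 1, 3, 5, 4, 0],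
    ![4, 0, 2, 1, 3, 5]] b a

/-- `σ₀`, the rotation about the axis through `0` and `3`. -/
def sig0 : Fin 6 → Fin 6 := fun a => octAct a 0

def etaTriples1 : List (Fin 6 × Fin 6 × Fin 6) :=
  [(0, 1, 2), (0, 3, 1), (1, 2, 0), (1, 4, 2), (3, 1, 5)]

def etaTriples2 : List (Fin 6 × Fin 6 × Fin 6) :=
  [(0, 1, 5), (1, 0, 1), (1, 0, 5), (1, 2, 1), (1, 3, 1), (1, 3, 2), (1, 4, 5), (1, 5, 1),
    (3, 0, 1), (3, 1, 0), (3, 1, 2)]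

/-- The 3-cocycle `η` of the octahedral quandle, on triples. -/
noncomputable def etaFun (a b c : Fin 6) : ZMod 3 := by
  classical
  exact
    if ∃ k : ℕ, ∃ p ∈ etaTriples1, a = sig0^[k] p.1 ∧ b = sig0^[k] p.2.1 ∧ c = sig0^[k] p.2.2
      then 1
    else if ∃ k : ℕ, ∃ p ∈ etaTriples2, a = sig0^[k] p.1 ∧ b = sig0^[k] p.2.1 ∧ c = sig0^[k] p.2.2
      then 2
    else 0

noncomputable def etaL : List (Fin 6) → ZMod 3
  | [a, b, c] => etaFun a b c
  | _ => 0

section Terms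

variable {op : X → X → X} {sact : S → X → S}

lemma gen_of_isChain {s : S} {l : List X} (h : l.IsChain (· ≠ ·)) :
    gen s l = Finsupp.single (⟨(s, l), h⟩ : Gen X S) 1 := by
  simp only [gen]
  exact dif_pos h

lemma gen_of_not_isChain {s : S} {l : List X} (h : ¬ l.IsChain (· ≠ ·)) :
    (gen s l : Ch X S) = 0 := by
  simp only [gen]
  exact dif_neg h

lemma fmap_zsmul_gen (ε : ℤ) (s : S) {a b c : X} (hab : a ≠ b) (hbc : b ≠ c) :
    fmap (ε • gen s [a, b, c]) =
      ε • (-gen s [b, c] + gen s [a, c] - gen s [a, b] : Ch X S) := by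
  have h : [a, b, c].IsChain (· ≠ ·) := by simp [hab, hbc]
  rw [gen_of_isChain h, Finsupp.smul_single, fmap, Finsupp.sum_single_index (by simp), fOn]
  simp [Fin.sum_univ_three, sub_eq_add_neg]

lemma gmap_zsmul_gen (ε : ℤ) (s : S) {a b c : X} (hab : a ≠ b) (hbc : b ≠ c) :
    gmap op sact (ε • gen s [a, b, c]) =
      ε • (gen (sact s a) [b, c] - gen (sact s b) [op a b, c]
        + gen (sact s c) [op a c, op b c] : Ch X S) := by
  have h : [a, b, c].IsChain (· ≠ ·) := by simp [hab, hbc]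
  rw [gen_of_isChain h, Finsupp.smul_single, gmap, Finsupp.sum_single_index (by simp), gOn]
  simp [Fin.sum_univ_three, sub_eq_add_neg]

/-- The linear functional on chains with prescribed values on generating tuples. -/
noncomputable def evalHom (h : S → List X → ℤ) : Ch X S →+ ℤ :=
  Finsupp.liftAddHom fun t => (AddMonoidHom.mulRight (h t.1.1 t.1.2))

lemma evalHom_gen_pair (h : S → List X → ℤ) (hh : ∀ s x, h s [x, x] = 0) (s : S) (x y : X) :
    evalHom h (gen s [x, y]) = h s [x, y] := by
  by_cases hxy : x = y
  · subst hxy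
    rw [gen_of_not_isChain (by simp), map_zero, hh]
  · rw [gen_of_isChain (by simpa using hxy)]
    simp [evalHom]

lemma filter_gen [DecidableEq S] (s₀ s : S) (l : List X) :
    Finsupp.filterAddHom (fun t : Gen X S => t.1.1 = s₀) (gen s l : Ch X S) =
      if s = s₀ then gen s l else 0 := by
  by_cases h : l.IsChain (· ≠ ·)
  · rw [gen_of_isChain h]
    split_ifs with hs
    · exact Finsupp.filter_single_of_pos _ hs
    · exact Finsupp.filter_single_of_neg _ hs
  · simp [gen_of_not_isChain h]

/-- All terms of an `f`-connected family have the same `S`-coordinate. -/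
lemma FConnected.eq_of_zsmul_gen [DecidableEq S] {k : ℕ} {γ : Fin k → Ch X S} (hf : FConnected γ)
    {ε : Fin k → ℤ} {s : Fin k → S} {a b c : Fin k → X} (hab : ∀ i, a i ≠ b i)
    (hbc : ∀ i, b i ≠ c i) (hγ : ∀ i, γ i = ε i • gen (s i) [a i, b i, c i]) (i j : Fin k) :
    s i = s j := by
  have hfilter (m) : Finsupp.filterAddHom (fun t : Gen X S => t.1.1 = s j) (fmap (γ m)) =
      if s m = s j then fmap (γ m) else 0 := by
    rw [hγ, fmap_zsmul_gen _ _ (hab m) (hbc m)]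
    simp only [map_zsmul, map_add, map_sub, map_neg, filter_gen]
    split_ifs <;> simp
  have hzero : ∑ m with s m = s j, fmap (γ m) = 0 := by
    have := congrArg (Finsupp.filterAddHom fun t : Gen X S => t.1.1 = s j) hf.2.1
    simpa only [map_sum, hfilter, map_zero, Finset.sum_filter] using this
  by_contra hij
  refine hf.2.2 _ ⟨j, by simp⟩ (fun h => hij ?_) hzero
  simpa using h.ge (Finset.mem_univ i)

/-- A linear functional vanishing on a family of signed elements, in which equal elements carry
equal signs, bounds the size of the family from below if it is close to a multiple of an
indicator function. -/
lemma le_of_sum_mul_eq_zero {T : Type*} [DecidableEq T] {k : ℕ} {ε : Fin k → ℤ} {t : Fin k → T}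
    (hε : ∀ i, ε i = 1 ∨ ε i = -1) (i₀ : Fin k) (hsign : ∀ i, t i = t i₀ → ε i = ε i₀)
    {w : T → ℤ} (hw : ∑ i, ε i * w (t i) = 0) {L D : ℤ} (hL : 0 ≤ L)
    (hbound : ∀ i, |(if t i = t i₀ then L else 0) + w (t i)| ≤ D) : L ≤ k * D := by
  calc L ≤ ∑ i, (if t i = t i₀ then L else 0) := by
        simpa using Finset.single_le_sum (f := fun i => if t i = t i₀ then L else 0)
          (fun i _ => by positivity) (Finset.mem_univ i₀)
    _ = ∑ i, ε i₀ * ε i * ((if t i = t i₀ then L else 0) + w (t i)) := by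
        simp only [mul_add, Finset.sum_add_distrib, mul_assoc, ← Finset.mul_sum, hw]
        rw [mul_zero, add_zero, Finset.mul_sum]
        refine Finset.sum_congr rfl fun i _ => ?_
        split_ifs with h
        · rw [hsign i h]
          rcases hε i₀ with h₀ | h₀ <;> simp [h₀]
        · simp
    _ ≤ ∑ _i : Fin k, D := by
        refine Finset.sum_le_sum fun i _ => (le_abs_self _).trans ?_
        rw [abs_mul]
        rcases hε i₀ with h₀ | h₀ <;> rcases hε i with h | h <;> simpa [h₀, h] using hbound i
    _ = k * D := by simp

end Terms

/-- The pullback to `3`-terms `(0; a, b, c)` of a pair of functions: `p` on the pairs occurring in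
the image of `f`, and `q` on the pairs occurring in the image of `g`, where the pair
`(2 * x; y, z)` is written `(x, y, z)`. -/
def coweight (p : ZMod 7 → ZMod 7 → ℤ) (q : ZMod 7 → ZMod 7 → ZMod 7 → ℤ) (a b c : ZMod 7) : ℤ :=
  -p b c + p a c - p a b + (q a b c - q b (R7op a b) c + q c (R7op a c) (R7op b c))

lemma sum_mul_coweight_eq_zero {n : ℤ} {l : ℕ} {γ : Fin l → Ch (ZMod 7) (ℤ × ZMod 7)}
    (hf : ∑ i, fmap (γ i) = 0) (hg : ∑ i, gmap R7op (zact R7op) (γ i) = 0)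
    {ε : Fin l → ℤ} {u : ZMod 7} {a b c : Fin l → ZMod 7} (hab : ∀ i, a i ≠ b i)
    (hbc : ∀ i, b i ≠ c i) (hγ : ∀ i, γ i = ε i • gen (n, u) [a i, b i, c i])
    (p : ZMod 7 → ZMod 7 → ℤ) (q : ZMod 7 → ZMod 7 → ZMod 7 → ℤ)
    (hp : ∀ x, p x x = 0) (hq : ∀ x y, q x y y = 0) :
    ∑ i, ε i * coweight p q (a i) (b i) (c i) = 0 := by
  let φ : ℤ × ZMod 7 → List (ZMod 7) → ℤ := fun _ m => p (m.getD 0 0) (m.getD 1 0)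
  let ψ : ℤ × ZMod 7 → List (ZMod 7) → ℤ := fun s m =>
    q (4 * (s.2 + u)) (m.getD 0 0) (m.getD 1 0)
  have hx (x : ZMod 7) : 4 * (2 * x) = x := by
    rw [← mul_assoc, show (4 * 2 : ZMod 7) = 1 from by decide, one_mul]
  have hφ (i) : evalHom φ (fmap (γ i)) =
      ε i * (-p (b i) (c i) + p (a i) (c i) - p (a i) (b i)) := by
    rw [hγ, fmap_zsmul_gen _ _ (hab i) (hbc i)]
    simp only [map_zsmul, map_add, map_sub, map_neg,
      evalHom_gen_pair φ (fun _ _ => hp _), smul_eq_mul]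
    rfl
  have hψ (i) : evalHom ψ (gmap R7op (zact R7op) (γ i)) =
      ε i * (q (a i) (b i) (c i) - q (b i) (R7op (a i) (b i)) (c i)
        + q (c i) (R7op (a i) (c i)) (R7op (b i) (c i))) := by
    rw [hγ, gmap_zsmul_gen _ _ (hab i) (hbc i)]
    simp only [map_zsmul, map_add, map_sub, evalHom_gen_pair ψ (fun _ _ => hq _ _), smul_eq_mul]
    simp [ψ, zact, R7op, hx]
  simp only [coweight, mul_add (ε _) (_ - _) (_ + _), Finset.sum_add_distrib, ← hφ, ← hψ]
  rw [← map_sum, ← map_sum, hf, hg, map_zero, map_zero, add_zero]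

/-- The function on pairs with the listed values, zero elsewhere. -/
def pairFun (L : List (ℕ × ℕ × ℤ)) (x y : ZMod 7) : ℤ :=
  (L.map fun e => if e.1 = x.val ∧ e.2.1 = y.val then e.2.2 else 0).sum

/-- The function on triples with the listed values, zero elsewhere. -/
def tripleFun (L : List (ℕ × ℕ × ℕ × ℤ)) (x y z : ZMod 7) : ℤ :=
  (L.map fun e => if e.1 = x.val ∧ e.2.1 = y.val ∧ e.2.2.1 = z.val then e.2.2.2 else 0).sum

/-- For each `t ≠ 0, 1`, a linear programming certificate showing that a `3`-chain without terms
`(a, b, a)`, annihilated by `f` and `g`, with a term `(0, 1, t)` has length at least `16`. -/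
lemma exists_certificate (t : ZMod 7) (h₀ : t ≠ 0) (h₁ : t ≠ 1) :
    ∃ (p : ZMod 7 → ZMod 7 → ℤ) (q : ZMod 7 → ZMod 7 → ZMod 7 → ℤ),
      (∀ x, p x x = 0) ∧ (∀ x y, q x y y = 0) ∧
      ∀ a b c, a ≠ b → b ≠ c → a ≠ c →
        |(if (a, b, c) = (0, 1, t) then 16 else 0) + coweight p q a b c| ≤ 1 := by
  fin_cases t
  · exact absurd rfl h₀
  · exact absurd rfl h₁
  · exact ⟨pairFun
      [(0, 1, 1), (1, 2, 1), (2, 5, -1), (3, 4, 1), (4, 3, -1), (5, 6, 1), (6, 5, -1)],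
      tripleFun
      [(0, 1, 2, -6), (0, 2, 3, -1), (0, 3, 4, -2), (0, 4, 5, -1), (0, 5, 6, -1), (2, 0, 6, -2),
       (2, 4, 3, -7), (2, 5, 4, -2), (2, 6, 5, -1), (3, 4, 2, 5), (3, 6, 4, -5), (4, 1, 5, -1),
       (4, 2, 6, -1), (4, 5, 2, 3), (5, 3, 6, 1), (6, 0, 2, -3), (6, 5, 0, 4)],
      by decide +kernel, by decide +kernel, by decide +kernel⟩
  · exact ⟨pairFun
      [(0, 5, -1), (1, 2, 1), (1, 3, 1), (1, 4, 1), (2, 3, 1), (2, 4, 1), (3, 1, -1), (3, 4, 1),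
       (4, 1, -1), (4, 2, -1), (5, 0, 1), (5, 6, 1), (6, 0, 1), (6, 5, -1)],
      tripleFun
      [(0, 1, 3, -2), (0, 2, 4, 2), (0, 3, 5, -2), (0, 4, 6, -3), (1, 2, 3, 5), (1, 4, 5, -3),
       (3, 1, 0, 1), (3, 5, 4, -3), (3, 6, 5, -7), (4, 0, 5, -3), (4, 3, 1, 1), (4, 5, 3, 2),
       (5, 0, 4, 1), (5, 3, 0, -3), (5, 4, 1, 4), (5, 6, 3, 1), (6, 2, 5, -4), (6, 5, 1, 4)],
      by decide +kernel, by decide +kernel, by decide +kernel⟩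
  · exact ⟨pairFun
      [(0, 1, 1), (0, 3, 1), (0, 6, -1), (1, 0, -1), (1, 3, -1), (1, 6, -1), (2, 4, 1), (2, 5, 1),
       (3, 0, -1), (3, 1, 1), (3, 6, 1), (4, 2, -1), (4, 5, 1), (5, 2, -1), (5, 4, -1), (6, 0, 1),
       (6, 1, 1), (6, 3, -1)],
      tripleFun
      [(0, 1, 3, -2), (0, 1, 4, -4), (0, 3, 6, 4), (0, 4, 6, 2), (1, 2, 4, 2), (1, 5, 0, -2),
       (4, 1, 0, -8), (5, 2, 0, -2), (5, 3, 1, 2), (6, 0, 4, -2), (6, 1, 5, 2), (6, 2, 0, -2),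
       (6, 5, 3, 2)],
      by decide +kernel, by decide +kernel, by decide +kernel⟩
  · exact ⟨pairFun
      [(0, 1, 1), (1, 0, -1), (1, 5, 1), (2, 3, 1), (2, 6, 1), (3, 2, -1), (3, 6, -1), (4, 1, 1),
       (4, 5, 1), (5, 0, -1), (5, 4, -1), (6, 2, -1), (6, 3, 1)],
      tripleFun
      [(0, 1, 5, -7), (0, 4, 1, -3), (0, 6, 5, 1), (1, 2, 5, 4), (1, 3, 6, -3), (2, 3, 5, 3),
       (2, 4, 6, -1), (2, 5, 0, -3), (3, 0, 1, -3), (3, 6, 0, 3), (5, 0, 6, 2), (5, 1, 0, -1),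
       (5, 2, 1, -1), (5, 3, 2, -2), (5, 4, 3, -2), (6, 0, 5, -4), (6, 2, 0, 2), (6, 4, 2, 3),
       (6, 5, 3, 1)],
      by decide +kernel, by decide +kernel, by decide +kernel⟩
  · exact ⟨pairFun
      [(0, 1, 1), (0, 2, -1), (0, 3, 1), (1, 0, -1), (1, 2, -1), (1, 3, -1), (2, 0, 1), (2, 1, 1),
       (2, 3, 1), (3, 0, -1), (3, 1, 1), (3, 2, -1), (4, 5, 1), (4, 6, -1), (5, 4, -1), (5, 6, 1),
       (6, 4, 1), (6, 5, -1)],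
      tripleFun
      [(0, 1, 6, -8), (1, 2, 6, 2), (1, 3, 0, -2), (2, 3, 6, 2), (2, 5, 1, -2), (4, 1, 2, -2),
       (4, 2, 5, -2), (4, 3, 6, 2), (4, 6, 0, 2), (6, 0, 4, -2), (6, 1, 0, 4), (6, 1, 5, 2),
       (6, 5, 4, -4)],
      by decide +kernel, by decide +kernel, by decide +kernel⟩

lemma coweight_comp_affine (p : ZMod 7 → ZMod 7 → ℤ) (q : ZMod 7 → ZMod 7 → ZMod 7 → ℤ)
    (k m a b c : ZMod 7) :
    coweight (fun x y => p (k * (x - m)) (k * (y - m)))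
        (fun x y z => q (k * (x - m)) (k * (y - m)) (k * (z - m))) a b c =
      coweight p q (k * (a - m)) (k * (b - m)) (k * (c - m)) := by
  have h (x y : ZMod 7) : k * (2 * y - x - m) = 2 * (k * (y - m)) - k * (x - m) := by ring
  simp only [coweight, R7op, h]

lemma coweight_indicator {m r a b c : ZMod 7} (hab : a ≠ b) :
    coweight 0 (fun x y z => if x = m ∧ y = m ∧ z = R7op r m then -1 else 0) a b c =
      if (a, b, c) = (m, r, m) then -1 else 0 := by
  have h₁ : ¬ (a = m ∧ b = m ∧ c = R7op r m) := fun h => hab (h.1.trans h.2.1.symm)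
  have h₂ : ¬ (b = m ∧ R7op a b = m ∧ c = R7op r m) := fun h => hab <| by
    have := h.2.1.trans h.1.symm
    simp only [R7op] at this
    linear_combination -this
  have h₃ : (c = m ∧ R7op a c = m ∧ R7op b c = R7op r m) ↔ (a, b, c) = (m, r, m) := by
    simp only [R7op, Prod.mk.injEq]
    constructor
    · rintro ⟨rfl, h, h'⟩
      exact ⟨by linear_combination -h, by linear_combination -h', rfl⟩
    · rintro ⟨rfl, rfl, rfl⟩
      exact ⟨rfl, by ring, rfl⟩
  simp [coweight, if_neg h₁, if_neg h₂, h₃]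

/-- simultaneously `f`- and `g`-connected 3-terms of `(R₇, ℤ × R₇)`
of a common degree number at least `16`. -/
theorem fg_connected_R7_sixteen (n : ℤ) (l : ℕ) (hl : 0 < l)
    (γ : Fin l → Ch (ZMod 7) (ℤ × ZMod 7)) (hterm : ∀ i, ∃ u, IsTerm3 (γ i) n u)
    (hf : FConnected γ) (hg : GConnected R7op (zact R7op) γ) :
    16 ≤ l := by
  choose u ε a b c hε hab hbc hγ using hterm
  have i₀ : Fin l := ⟨0, hl⟩
  have hu (i) : u i = u i₀ := congrArg Prod.snd (hf.eq_of_zsmul_gen hab hbc hγ i i₀)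
  replace hγ (i) : γ i = ε i • gen (n, u i₀) [a i, b i, c i] := by rw [hγ i, hu i]
  have hsum := sum_mul_coweight_eq_zero hf.2.1 hg.2.1 hab hbc hγ
  let t (i : Fin l) : ZMod 7 × ZMod 7 × ZMod 7 := (a i, b i, c i)
  have hsign (j i : Fin l) (h : t i = t j) : ε i = ε j := by
    simp only [t, Prod.mk.injEq] at h
    by_contra hne
    have hneg : ε i = -ε j := by rcases hε i with h | h <;> rcases hε j with h' | h' <;> simp_all
    exact hf.1 i j (fun hij => hne (hij ▸ rfl))
      (by rw [hγ i, hγ j, hneg, h.1, h.2.1, h.2.2, neg_smul])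
  have hac (j) : a j ≠ c j := by
    intro hj
    have hw := hsum 0 (fun x y z => if x = a j ∧ y = a j ∧ z = R7op (b j) (a j) then -1 else 0)
      (fun _ => rfl) (fun x y => if_neg fun h => hab j <| by
        have := h.2.1.symm.trans h.2.2
        simp only [R7op] at this
        linear_combination -this)
    simp only [coweight_indicator (hab _)] at hw
    have := le_of_sum_mul_eq_zero (t := t) (w := fun x => if x = (a j, b j, a j) then -1 else 0)
      hε j (hsign j) hw zero_le_one (D := 0) (fun i => by
        simp only [t, ← hj]
        split_ifs <;> simp)
    simp at this
  have hba : b i₀ - a i₀ ≠ 0 := sub_ne_zero.2 (hab i₀).symm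
  have : Fact (Nat.Prime 7) := ⟨by norm_num⟩
  set k := (b i₀ - a i₀)⁻¹
  have hkk : k ≠ 0 := inv_ne_zero hba
  have hinj (x y : ZMod 7) (h : k * (x - a i₀) = k * (y - a i₀)) : x = y :=
    sub_left_injective (mul_left_cancel₀ hkk h)
  have hk₀ : k * (a i₀ - a i₀) = 0 := by simp
  have hk₁ : k * (b i₀ - a i₀) = 1 := inv_mul_cancel₀ hba
  obtain ⟨p, q, hp, hq, hpq⟩ := exists_certificate (k * (c i₀ - a i₀))
    (fun h => hac i₀ (hinj _ _ (hk₀.trans h.symm)))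
    (fun h => hbc i₀ (hinj _ _ (hk₁.trans h.symm)))
  have hw := hsum (fun x y => p (k * (x - a i₀)) (k * (y - a i₀)))
    (fun x y z => q (k * (x - a i₀)) (k * (y - a i₀)) (k * (z - a i₀)))
    (fun _ => hp _) (fun _ _ => hq _ _)
  simp only [coweight_comp_affine p q k (a i₀)] at hw
  have := le_of_sum_mul_eq_zero (t := t) (w := fun x =>
    coweight p q (k * (x.1 - a i₀)) (k * (x.2.1 - a i₀)) (k * (x.2.2 - a i₀)))
    hε i₀ (hsign i₀) hw (L := 16) (D := 1) (by norm_num) (fun i => by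
      convert hpq (k * (a i - a i₀)) (k * (b i - a i₀)) (k * (c i - a i₀))
        (fun h => hab i (hinj _ _ h)) (fun h => hbc i (hinj _ _ h))
        (fun h => hac i (hinj _ _ h)) using 4
      simp only [t, Prod.mk.injEq]
      rw [← hk₁]
      conv_rhs => rw [← hk₀]
      exact ⟨fun ⟨h, h', h''⟩ => by simp [h, h', h''],
        fun ⟨h, h', h''⟩ => ⟨hinj _ _ h, hinj _ _ h', hinj _ _ h''⟩⟩)
  exact_mod_cast this.trans_eq (mul_one _)

end QHom
end

section
/- Let γ be a 3-cycle of (R₇, ℤ×R₇) whose length l = l(γ) satisfies 1 ≤ l ≤ 7. Then γ or its reverse γ̄ (again a 3-cycle of (R₇, ℤ×R₇), since R₇ coincides with its dual quandle) satisfies one of the following, where n denotes its minimal degree: (A) 4 ≤ l ≤ 7 and |T_n| = l; (B) 6 ≤ l ≤ 7, |T_n| = 2 and |T_{n+1}| = l − 2; (C) 6 ≤ l ≤ 7, |T_n| = 3 and |T_{n+1}| = l − 3. -/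
namespace QHom

variable {X S : Type*}

/-- A signed 3-term `sgn • (deg, idx; a, b, c)` of `(R₇, ℤ × R₇)`. -/
@[ext] structure Term where
  sgn : ℤ
  deg : ℤ
  idx : ZMod 7
  a : ZMod 7
  b : ZMod 7
  c : ZMod 7

namespace Term

/-- The sign is `±1` and the tuple is nondegenerate. -/
structure Good (t : Term) : Prop where
  sgn : t.sgn = 1 ∨ t.sgn = -1
  hab : t.a ≠ t.b
  hbc : t.b ≠ t.c

/-- Two signed terms that cancel. -/
def Opp (s t : Term) : Prop :=
  s.deg = t.deg ∧ s.idx = t.idx ∧ s.a = t.a ∧ s.b = t.b ∧ s.c = t.c ∧ s.sgn = -t.sgn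

/-- The coefficient of `(p, q)` in `-f t`, disregarding the sign of `t`. -/
def fAt (t : Term) (p q : ZMod 7) : ℤ :=
  (if t.b = p ∧ t.c = q then 1 else 0) - (if t.a = p ∧ t.c = q then 1 else 0) +
    (if t.a = p ∧ t.b = q then 1 else 0)

/-- The coefficient of the pair `(p, q)` of index `v` in `g t`, disregarding the sign of `t`. -/
def gAt (t : Term) (v p q : ZMod 7) : ℤ :=
  (if 2 * t.a - t.idx = v then if t.b = p ∧ t.c = q then 1 else 0 else 0) -
    (if 2 * t.b - t.idx = v then if 2 * t.b - t.a = p ∧ t.c = q then 1 else 0 else 0) +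
    (if 2 * t.c - t.idx = v then if 2 * t.c - t.a = p ∧ 2 * t.c - t.b = q then 1 else 0 else 0)

/-- The sum of the coefficients of `-f t`, disregarding the sign of `t`. -/
def fAug (t : Term) : ℤ := if t.a = t.c then 2 else 1

/-- The sum of the coefficients of the part of `g t` at index `v`. -/
def gAug (t : Term) (v : ZMod 7) : ℤ :=
  (if 2 * t.a - t.idx = v then 1 else 0) -
    (if 2 * t.b - t.idx = v then if 2 * t.b - t.a ≠ t.c then 1 else 0 else 0) +
    (if 2 * t.c - t.idx = v then 1 else 0)

theorem sum_offDiag_ite (x y : ZMod 7) :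
    ∑ z ∈ (Finset.univ : Finset (ZMod 7)).offDiag, (if x = z.1 ∧ y = z.2 then (1 : ℤ) else 0) =
      if x ≠ y then 1 else 0 := by
  have h : ∀ z : ZMod 7 × ZMod 7, (x = z.1 ∧ y = z.2) ↔ (x, y) = z := fun z => by
    rw [Prod.ext_iff]
  simp only [h, Finset.sum_ite_eq, Finset.mem_offDiag, Finset.mem_univ, true_and]

theorem Good.sum_fAt {t : Term} (ht : t.Good) :
    ∑ z ∈ (Finset.univ : Finset (ZMod 7)).offDiag, t.fAt z.1 z.2 = t.fAug := by
  simp only [fAt, Finset.sum_add_distrib, Finset.sum_sub_distrib, sum_offDiag_ite, fAug,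
    if_pos ht.hab, if_pos ht.hbc]
  split_ifs <;> simp_all

theorem Good.sum_gAt {t : Term} (ht : t.Good) (v : ZMod 7) :
    ∑ z ∈ (Finset.univ : Finset (ZMod 7)).offDiag, t.gAt v z.1 z.2 = t.gAug v := by
  have h : ∀ (P : Prop) [Decidable P] (x y : ZMod 7),
      ∑ z ∈ (Finset.univ : Finset (ZMod 7)).offDiag,
        (if P then if x = z.1 ∧ y = z.2 then (1 : ℤ) else 0 else 0) =
      if P then if x ≠ y then 1 else 0 else 0 := by
    intro P _ x y
    by_cases hP : P
    · simp only [hP, if_true, sum_offDiag_ite]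
    · simp [hP]
  have h' : 2 * t.c - t.a ≠ 2 * t.c - t.b := fun e => ht.hab (sub_right_injective e)
  simp only [gAt, Finset.sum_add_distrib, Finset.sum_sub_distrib, h, gAug, if_pos ht.hbc, if_pos h']

theorem Good.abs_fAug {t : Term} (ht : t.Good) : |t.sgn * t.fAug| ≤ 2 := by
  rcases ht.sgn with h | h <;> rw [h, fAug] <;> split_ifs <;> decide

theorem two_mul_sub_left_inj (u x y : ZMod 7) : 2 * x - u = 2 * y - u ↔ x = y := by
  revert u x y; decide

theorem Good.single {t : Term} (ht : t.Good) (h : ∀ p q, p ≠ q → t.sgn * t.fAt p q = 0) :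
    False := by
  obtain ⟨s, n, u, a, b, c⟩ := t
  obtain ⟨hs, h1, h2⟩ := ht
  have := h a b h1
  simp only [Term.fAt] at *
  grind

/-- An `f`-cycle consisting of two terms is a bigon. -/
theorem Good.pair {s t : Term} (hs : s.Good) (ht : t.Good)
    (hne : ¬ (s.a = t.a ∧ s.b = t.b ∧ s.c = t.c ∧ s.sgn = -t.sgn))
    (h : ∀ p q, p ≠ q → s.sgn * s.fAt p q + t.sgn * t.fAt p q = 0) :
    t.sgn = -s.sgn ∧ s.a = s.c ∧ t.a = s.b ∧ t.b = s.a ∧ t.c = s.b := by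
  obtain ⟨s, n, u, a, b, c⟩ := s
  obtain ⟨s', n', u', a', b', c'⟩ := t
  obtain ⟨hs, h1, h2⟩ := hs
  obtain ⟨hs', h1', h2'⟩ := ht
  have e1 := h a b h1
  have e2 := h b c h2
  have e3 := h a' b' h1'
  have e4 := h b' c' h2'
  have e5 := h a c
  have e6 := h a' c'
  simp only [Term.fAt] at *
  clear h
  grind (splits := 40)

/-- The shape of an `f`-cycle consisting of three terms. -/
theorem Good.triple {r s t : Term} (hr : r.Good) (hs : s.Good) (ht : t.Good) (hac : r.a = r.c)
    (hac' : s.a ≠ s.c) (hac'' : t.a ≠ t.c) (es : s.sgn = -r.sgn) (et : t.sgn = -r.sgn)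
    (h : ∀ p q, p ≠ q → r.sgn * r.fAt p q + s.sgn * s.fAt p q + t.sgn * t.fAt p q = 0) :
    ((s.a = t.a ∧ s.b = t.c ∧ s.c = t.b) ∨ (s.c = t.c ∧ s.b = t.a ∧ s.a = t.b)) ∧
      ∀ x, (x = r.a ∨ x = r.b) →
        (s.a = t.a ∧ (s.b = x ∨ s.c = x)) ∨ (s.c = t.c ∧ (s.a = x ∨ s.b = x)) := by
  obtain ⟨s, n, u, a, b, c⟩ := s
  obtain ⟨s', n', u', a', b', c'⟩ := t
  obtain ⟨s'', n'', u'', a'', b'', c''⟩ := r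
  obtain ⟨hs, h1, h2⟩ := hs
  obtain ⟨hs', h1', h2'⟩ := ht
  obtain ⟨hs'', h1'', h2''⟩ := hr
  dsimp only at *
  subst es et hac
  have key : ∀ p q, p ≠ q → Term.fAt ⟨1, 0, 0, a'', b'', a''⟩ p q =
      Term.fAt ⟨1, 0, 0, a, b, c⟩ p q + Term.fAt ⟨1, 0, 0, a', b', c'⟩ p q := by
    intro p q hpq
    have := h p q hpq
    simp only [Term.fAt] at *
    rcases hs'' with rfl | rfl <;> linarith
  clear h hs hs' hs''
  have e1 := key a b h1
  have e2 := key b c h2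
  have e3 := key a' b' h1'
  have e4 := key b' c' h2'
  have e5 := key a c hac'
  have e6 := key a' c' hac''
  have e7 := key a'' b'' h1''
  have e8 := key b'' a'' h1''.symm
  simp only [Term.fAt] at *
  clear key
  grind (splits := 40)

/-- The image under `g` of a bigon has augmentation `±3` at two indices. -/
theorem Good.pair_gAug {s t : Term} (hs : s.Good) (ht : t.Good) (hidx : s.idx = t.idx)
    (hne : ¬ (s.a = t.a ∧ s.b = t.b ∧ s.c = t.c ∧ s.sgn = -t.sgn))
    (h : ∀ p q, p ≠ q → s.sgn * s.fAt p q + t.sgn * t.fAt p q = 0) :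
    ∃ v w, v ≠ w ∧ 2 < |s.sgn * s.gAug v + t.sgn * t.gAug v| ∧
      2 < |s.sgn * s.gAug w + t.sgn * t.gAug w| := by
  obtain ⟨h1, h2, h3, h4, h5⟩ := hs.pair ht hne h
  refine ⟨2 * s.a - s.idx, 2 * s.b - s.idx, ?_, ?_, ?_⟩
  · rw [Ne, two_mul_sub_left_inj]; exact hs.hab
  · have := hs.hab
    have e : 2 * s.a - s.b ≠ s.b := by
      revert this; generalize s.a = a; generalize s.b = b; revert a b; decide
    simp only [gAug, h1, h3, h4, h5, ← hidx, ← h2, two_mul_sub_left_inj]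
    rcases hs.sgn with h | h <;> simp [h, this.symm, e]
  · have := hs.hab
    have e : 2 * s.b - s.a ≠ s.a := by
      revert this; generalize s.a = a; generalize s.b = b; revert a b; decide
    simp only [gAug, h1, h3, h4, h5, ← hidx, ← h2, two_mul_sub_left_inj]
    rcases hs.sgn with h | h <;> simp [h, this, e]

theorem Good.triple_gAug_aux {r s t : Term} (hr : r.Good) (hs : s.Good) (ht : t.Good)
    (hac : r.a = r.c) (hac' : s.a ≠ s.c) (hac'' : t.a ≠ t.c) (es : s.sgn = -r.sgn)
    (et : t.sgn = -r.sgn) (hrs : r.idx = s.idx) (hrt : r.idx = t.idx)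
    (h : ∀ p q, p ≠ q → r.sgn * r.fAt p q + s.sgn * s.fAt p q + t.sgn * t.fAt p q = 0) :
    ∃ v w, v ≠ w ∧ r.sgn * r.gAug v + s.sgn * s.gAug v + t.sgn * t.gAug v ≠ 0 ∧
      r.sgn * r.gAug w + s.sgn * s.gAug w + t.sgn * t.gAug w ≠ 0 := by
  obtain ⟨h1, h2⟩ := hr.triple hs ht hac hac' hac'' es et h
  have h3 := h2 r.a (Or.inl rfl)
  have h4 := h2 r.b (Or.inr rfl)
  have hab := hr.hab
  have hab' := hs.hab
  have hbc' := hs.hbc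
  have hab'' := ht.hab
  have hbc'' := ht.hbc
  clear h h2
  have hx : ∃ x, (x = s.a ∧ s.a = t.a ∨ x = s.c ∧ s.c = t.c) ∧ x ≠ r.a := by
    rcases h1 with h1 | h1
    · exact ⟨s.a, Or.inl ⟨rfl, h1.1⟩, by grind⟩
    · exact ⟨s.c, Or.inr ⟨rfl, h1.1⟩, by grind⟩
  obtain ⟨x, hx, hxa⟩ := hx
  refine ⟨2 * x - r.idx, 2 * r.a - r.idx, ?_, ?_, ?_⟩
  · rw [Ne, two_mul_sub_left_inj]; exact hxa
  · simp only [gAug, es, et, ← hrs, ← hrt, two_mul_sub_left_inj, ← hac]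
    have := hr.sgn
    generalize 2 * r.b - r.a = z1
    generalize 2 * s.b - s.a = z2
    generalize 2 * t.b - t.a = z3
    grind (splits := 40)
  · simp only [gAug, es, et, ← hrs, ← hrt, two_mul_sub_left_inj, ← hac]
    have := hr.sgn
    generalize 2 * r.b - r.a = z1
    generalize 2 * s.b - s.a = z2
    generalize 2 * t.b - t.a = z3
    grind (splits := 40)

/-- The image under `g` of an `f`-cycle with three terms has nonzero augmentation at two
indices. -/
theorem Good.triple_gAug {r s t : Term} (hr : r.Good) (hs : s.Good) (ht : t.Good)
    (hrs : r.idx = s.idx) (hrt : r.idx = t.idx)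
    (h : ∀ p q, p ≠ q → r.sgn * r.fAt p q + s.sgn * s.fAt p q + t.sgn * t.fAt p q = 0) :
    ∃ v w, v ≠ w ∧ r.sgn * r.gAug v + s.sgn * s.gAug v + t.sgn * t.gAug v ≠ 0 ∧
      r.sgn * r.gAug w + s.sgn * s.gAug w + t.sgn * t.gAug w ≠ 0 := by
  have haug : r.sgn * r.fAug + s.sgn * s.fAug + t.sgn * t.fAug = 0 := by
    rw [← hr.sum_fAt, ← hs.sum_fAt, ← ht.sum_fAt]
    simp only [Finset.mul_sum, ← Finset.sum_add_distrib]
    exact Finset.sum_eq_zero fun z hz => h _ _ (Finset.mem_offDiag.1 hz).2.2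
  have hr' := hr.sgn
  have hs' := hs.sgn
  have ht' := ht.sgn
  simp only [fAug] at haug
  by_cases h1 : r.a = r.c
  · exact hr.triple_gAug_aux hs ht h1 (by grind) (by grind) (by grind) (by grind) hrs hrt h
  by_cases h2 : s.a = s.c
  · obtain ⟨v, w, hvw, hv, hw⟩ := hs.triple_gAug_aux hr ht h2 h1 (by grind) (by grind) (by grind)
      hrs.symm (hrs.symm.trans hrt) fun p q hpq => by rw [← h p q hpq]; ring
    exact ⟨v, w, hvw, by grind, by grind⟩
  · obtain ⟨v, w, hvw, hv, hw⟩ := ht.triple_gAug_aux hr hs (by grind) h1 h2 (by grind) (by grind)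
      hrt.symm (hrt.symm.trans hrs) fun p q hpq => by rw [← h p q hpq]; ring
    exact ⟨v, w, hvw, by grind, by grind⟩

end Term

/-- The contribution of `t` to the coefficient of `∂` at `(k, u; p, q)`, disregarding its sign. -/
def Term.bdAt (t : Term) (k : ℤ) (u p q : ZMod 7) : ℤ :=
  (if t.deg + 1 = k then t.gAt u p q else 0) - (if t.deg = k ∧ t.idx = u then t.fAt p q else 0)

/-- A multiset of nondegenerate signed terms without cancellation representing a 3-cycle. -/
structure IsCycle (M : Multiset Term) : Prop where
  good : ∀ t ∈ M, t.Good
  not_opp : ∀ s ∈ M, ∀ t ∈ M, ¬ s.Opp t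
  bd : ∀ k u p q, p ≠ q → (M.map fun t => t.sgn * t.bdAt k u p q).sum = 0

/-- The terms of degree `k`. -/
def layer (M : Multiset Term) (k : ℤ) : Multiset Term := M.filter fun t => t.deg = k

/-- The terms of degree `k` and index `u`. -/
def cell (M : Multiset Term) (k : ℤ) (u : ZMod 7) : Multiset Term :=
  M.filter fun t => t.deg = k ∧ t.idx = u

theorem sum_map_filter (M : Multiset Term) (P : Term → Prop) [DecidablePred P] (h : Term → ℤ) :
    ((M.filter P).map h).sum = (M.map fun t => if P t then h t else 0).sum := by
  induction M using Multiset.induction_on with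
  | empty => simp
  | cons t M ih => by_cases ht : P t <;> simp [ht, ih]

theorem cell_le_layer (M : Multiset Term) (k : ℤ) (u : ZMod 7) : cell M k u ≤ layer M k :=
  Multiset.monotone_filter_right M fun _ h => h.1

theorem card_filter_add_le {N : Multiset Term} {P Q : Term → Prop} [DecidablePred P]
    [DecidablePred Q] (h : ∀ t, P t → ¬ Q t) :
    (N.filter P).card + (N.filter Q).card ≤ N.card := by
  have e : N.filter (fun t => P t ∧ Q t) = 0 :=
    Multiset.filter_eq_nil.2 fun t _ ht => h t ht.1 ht.2
  rw [← Multiset.card_add, Multiset.filter_add_filter, e, add_zero]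
  exact Multiset.card_le_card (Multiset.filter_le _ _)

theorem card_cell_add_le (M : Multiset Term) (k : ℤ) {u v : ZMod 7} (h : u ≠ v) :
    (cell M k u).card + (cell M k v).card ≤ (layer M k).card := by
  have e : ∀ w, cell M k w = (layer M k).filter fun t => t.idx = w := fun w => by
    rw [cell, layer, Multiset.filter_filter]
    exact Multiset.filter_congr fun t _ => and_comm
  rw [e, e]
  exact card_filter_add_le fun t h1 h2 => h (h1.symm.trans h2)

theorem sum_map_finset_sum {ι : Type*} (M : Multiset Term) (s : Finset ι) (F : Term → ι → ℤ) :
    (M.map fun t => ∑ z ∈ s, F t z).sum = ∑ z ∈ s, (M.map fun t => F t z).sum :=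
  Multiset.sum_map_sum_map _ _

namespace IsCycle

variable {M : Multiset Term}

theorem sum_cell (hM : IsCycle M) (k : ℤ) (v p q : ZMod 7) (hpq : p ≠ q) :
    ((cell M (k + 1) v).map fun t => t.sgn * t.fAt p q).sum =
      ((layer M k).map fun t => t.sgn * t.gAt v p q).sum := by
  have h := hM.bd (k + 1) v p q hpq
  have e : ∀ t ∈ M, t.sgn * t.bdAt (k + 1) v p q =
      (if t.deg = k then t.sgn * t.gAt v p q else 0) -
        (if t.deg = k + 1 ∧ t.idx = v then t.sgn * t.fAt p q else 0) := fun t _ => by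
    simp only [Term.bdAt, add_left_inj]
    split_ifs <;> ring
  rw [Multiset.map_congr rfl e, Multiset.sum_map_sub, sub_eq_zero] at h
  rw [cell, layer, sum_map_filter, sum_map_filter, h]

theorem sum_cell_eq_zero (hM : IsCycle M) {k : ℤ} (hk : layer M (k - 1) = 0) (u p q : ZMod 7)
    (hpq : p ≠ q) : ((cell M k u).map fun t => t.sgn * t.fAt p q).sum = 0 := by
  have h := hM.sum_cell (k - 1) u p q hpq
  rwa [sub_add_cancel, hk, Multiset.map_zero, Multiset.sum_zero] at h

theorem sum_cell_fAug (hM : IsCycle M) (k : ℤ) (v : ZMod 7) :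
    ((cell M (k + 1) v).map fun t => t.sgn * t.fAug).sum =
      ((layer M k).map fun t => t.sgn * t.gAug v).sum := by
  have e1 : ∀ t ∈ cell M (k + 1) v, t.sgn * t.fAug =
      ∑ z ∈ (Finset.univ : Finset (ZMod 7)).offDiag, t.sgn * t.fAt z.1 z.2 := fun t ht => by
    rw [← Finset.mul_sum, (hM.good t (Multiset.mem_of_mem_filter ht)).sum_fAt]
  have e2 : ∀ t ∈ layer M k, t.sgn * t.gAug v =
      ∑ z ∈ (Finset.univ : Finset (ZMod 7)).offDiag, t.sgn * t.gAt v z.1 z.2 := fun t ht => by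
    rw [← Finset.mul_sum, (hM.good t (Multiset.mem_of_mem_filter ht)).sum_gAt]
  rw [Multiset.map_congr rfl e1, Multiset.map_congr rfl e2, sum_map_finset_sum,
    sum_map_finset_sum]
  exact Finset.sum_congr rfl fun z hz => hM.sum_cell k v _ _ (Finset.mem_offDiag.1 hz).2.2

theorem abs_sum_le (hM : IsCycle M) (k : ℤ) (v : ZMod 7) :
    |((layer M k).map fun t => t.sgn * t.gAug v).sum| ≤ 2 * (cell M (k + 1) v).card := by
  rw [← hM.sum_cell_fAug]
  have h : ∀ N : Multiset Term, (∀ t ∈ N, t.Good) →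
      |(N.map fun t => t.sgn * t.fAug).sum| ≤ 2 * N.card := by
    intro N
    induction N using Multiset.induction_on with
    | empty => simp
    | cons t N ih =>
      intro hN
      have h1 := (hN t (Multiset.mem_cons_self t N)).abs_fAug
      have h2 := ih fun s hs => hN s (Multiset.mem_cons_of_mem hs)
      rw [Multiset.map_cons, Multiset.sum_cons, Multiset.card_cons]
      push_cast
      have h3 := abs_add_le (t.sgn * t.fAug) (N.map fun t => t.sgn * t.fAug).sum
      linarith
  exact h _ fun t ht => hM.good t (Multiset.mem_of_mem_filter ht)

theorem card_cell_ne_one (hM : IsCycle M) {k : ℤ} (hk : layer M (k - 1) = 0) (u : ZMod 7) :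
    (cell M k u).card ≠ 1 := by
  intro h
  obtain ⟨t, ht⟩ := Multiset.card_eq_one.1 h
  have hmem : t ∈ cell M k u := by rw [ht]; exact Multiset.mem_singleton_self t
  refine (hM.good t (Multiset.mem_of_mem_filter hmem)).single fun p q hpq => ?_
  simpa [ht] using hM.sum_cell_eq_zero hk u p q hpq

theorem two_le_card_cell (hM : IsCycle M) {k : ℤ} (hk : layer M (k - 1) = 0) {t : Term}
    (ht : t ∈ layer M k) : 2 ≤ (cell M k t.idx).card := by
  have h1 := hM.card_cell_ne_one hk t.idx
  have h2 : 0 < (cell M k t.idx).card := Multiset.card_pos_iff_exists_mem.2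
    ⟨t, Multiset.mem_filter.2 ⟨Multiset.mem_of_mem_filter ht, (Multiset.mem_filter.1 ht).2, rfl⟩⟩
  omega

theorem two_le_card_layer (hM : IsCycle M) {k : ℤ} (hk : layer M (k - 1) = 0)
    (h0 : layer M k ≠ 0) : 2 ≤ (layer M k).card := by
  obtain ⟨t, ht⟩ := Multiset.exists_mem_of_ne_zero h0
  exact (hM.two_le_card_cell hk ht).trans (Multiset.card_le_card (cell_le_layer M k _))

/-- A layer with at most three terms which is an `f`-cycle has a constant index. -/
theorem cell_eq_layer (hM : IsCycle M) {k : ℤ} (hk : layer M (k - 1) = 0)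
    (h3 : (layer M k).card ≤ 3) {t : Term} (ht : t ∈ layer M k) : cell M k t.idx = layer M k := by
  refine (Multiset.filter_congr fun s hs => ⟨fun h => h.1, fun h => ⟨h, ?_⟩⟩)
  by_contra hne
  have h1 := hM.two_le_card_cell hk (Multiset.mem_filter.2 ⟨hs, h⟩)
  have h2 := hM.two_le_card_cell hk ht
  have h3 := card_cell_add_le M k hne
  omega

theorem four_le_of_card_eq_two (hM : IsCycle M) {k : ℤ} (hk : layer M (k - 1) = 0)
    (h2 : (layer M k).card = 2) : 4 ≤ (layer M (k + 1)).card := by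
  obtain ⟨s, t, hst⟩ := Multiset.card_eq_two.1 h2
  have hs : s ∈ layer M k := by simp [hst]
  have ht : t ∈ layer M k := by simp [hst]
  have hc := hM.cell_eq_layer hk (by omega) hs
  have hi : t.idx = s.idx := (Multiset.mem_filter.1 (hc ▸ ht : t ∈ cell M k s.idx)).2.2
  have hd : s.deg = t.deg := ((Multiset.mem_filter.1 hs).2).trans ((Multiset.mem_filter.1 ht).2).symm
  obtain ⟨v, w, hvw, hv, hw⟩ := (hM.good s (Multiset.mem_of_mem_filter hs)).pair_gAug
    (hM.good t (Multiset.mem_of_mem_filter ht)) hi.symm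
    (fun h => hM.not_opp s (Multiset.mem_of_mem_filter hs) t (Multiset.mem_of_mem_filter ht)
      ⟨hd, hi.symm, h⟩)
    (fun p q hpq => by simpa [hc, hst] using hM.sum_cell_eq_zero hk s.idx p q hpq)
  have h1 := hM.abs_sum_le k v
  have h2 := hM.abs_sum_le k w
  simp only [hst, Multiset.insert_eq_cons, Multiset.map_cons, Multiset.map_singleton,
    Multiset.sum_cons, Multiset.sum_singleton] at h1 h2
  have h3 := card_cell_add_le M (k + 1) hvw
  omega

theorem two_le_of_card_eq_three (hM : IsCycle M) {k : ℤ} (hk : layer M (k - 1) = 0)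
    (h3 : (layer M k).card = 3) : 2 ≤ (layer M (k + 1)).card := by
  obtain ⟨r, s, t, hst⟩ := Multiset.card_eq_three.1 h3
  have hr : r ∈ layer M k := by simp [hst]
  have hs : s ∈ layer M k := by simp [hst]
  have ht : t ∈ layer M k := by simp [hst]
  have hc := hM.cell_eq_layer hk h3.le hr
  have hi : s.idx = r.idx := (Multiset.mem_filter.1 (hc ▸ hs : s ∈ cell M k r.idx)).2.2
  have hi' : t.idx = r.idx := (Multiset.mem_filter.1 (hc ▸ ht : t ∈ cell M k r.idx)).2.2
  obtain ⟨v, w, hvw, hv, hw⟩ := (hM.good r (Multiset.mem_of_mem_filter hr)).triple_gAug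
    (hM.good s (Multiset.mem_of_mem_filter hs)) (hM.good t (Multiset.mem_of_mem_filter ht))
    hi.symm hi'.symm
    (fun p q hpq => by simpa [hc, hst, add_assoc] using hM.sum_cell_eq_zero hk r.idx p q hpq)
  have h1 := hM.abs_sum_le k v
  have h2 := hM.abs_sum_le k w
  rw [← abs_pos] at hv hw
  simp only [hst, Multiset.insert_eq_cons, Multiset.map_cons, Multiset.map_singleton,
    Multiset.sum_cons, Multiset.sum_singleton, ← add_assoc] at h1 h2
  have h3 := card_cell_add_le M (k + 1) hvw
  omega

end IsCycle

namespace Term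

/-- The reverse of a signed term. -/
def rev (t : Term) : Term where
  sgn := t.sgn
  deg := -t.deg
  idx := 2 * t.c - (2 * t.b - (2 * t.a - t.idx))
  a := 2 * t.c - (2 * t.b - t.a)
  b := 2 * t.c - t.b
  c := t.c

theorem rev_rev (t : Term) : t.rev.rev = t := by
  ext <;> simp only [rev] <;> ring

theorem Good.rev {t : Term} (ht : t.Good) : t.rev.Good where
  sgn := ht.sgn
  hab := by
    have := ht.hab
    simp only [Term.rev, Ne, sub_right_inj]
    intro h
    revert this h; generalize t.a = a; generalize t.b = b; revert a b; decide
  hbc := by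
    have := ht.hbc
    simp only [Term.rev]
    revert this; generalize t.b = a; generalize t.c = b; revert a b; decide

theorem Opp.rev {s t : Term} (h : s.Opp t) : s.rev.Opp t.rev := by
  obtain ⟨h1, h2, h3, h4, h5, h6⟩ := h
  simp only [Opp, Term.rev, h1, h2, h3, h4, h5, h6, and_self]

theorem fAt_rev (t : Term) (k : ℤ) (u p q : ZMod 7) :
    (if t.rev.deg = k ∧ t.rev.idx = u then t.rev.fAt p q else 0) =
      if t.deg + 1 = 1 - k then t.gAt (2 * q - (2 * p - u)) (2 * q - p) q else 0 := by
  have hk : t.rev.deg = k ↔ t.deg + 1 = 1 - k := by simp only [rev]; omega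
  by_cases h : t.deg + 1 = 1 - k
  · rw [if_pos h]
    simp only [hk, h, true_and, fAt, gAt, ← ite_and]
    have h1 : ∀ u a b c v p q : ZMod 7, (2 * a - u = 2 * q - (2 * p - v) ∧ b = 2 * q - p ∧ c = q) ↔
        (2 * c - (2 * b - (2 * a - u)) = v ∧ 2 * c - b = p ∧ c = q) := by
      intros; constructor <;> rintro ⟨h1, h2, rfl⟩
      · subst h2; refine ⟨?_, by ring, rfl⟩; rw [h1]; ring
      · subst h1 h2; refine ⟨by ring, by ring, rfl⟩
    have h2 : ∀ u a b c v p q : ZMod 7,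
        (2 * b - u = 2 * q - (2 * p - v) ∧ 2 * b - a = 2 * q - p ∧ c = q) ↔
        (2 * c - (2 * b - (2 * a - u)) = v ∧ 2 * c - (2 * b - a) = p ∧ c = q) := by
      intros; constructor <;> rintro ⟨h1, h2, rfl⟩
      · rw [h2]; refine ⟨?_, by ring, rfl⟩
        linear_combination h1 - 2 * h2
      · subst h1 h2; refine ⟨by ring, by ring, rfl⟩
    have h3 : ∀ u a b c v p q : ZMod 7,
        (2 * c - u = 2 * q - (2 * p - v) ∧ 2 * c - a = 2 * q - p ∧ 2 * c - b = q) ↔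
        (2 * c - (2 * b - (2 * a - u)) = v ∧ 2 * c - (2 * b - a) = p ∧ 2 * c - b = q) := by
      intros; constructor <;> rintro ⟨h1, h2, rfl⟩
      · refine ⟨?_, ?_, rfl⟩
        · linear_combination h1 - 2 * h2
        · linear_combination -h2
      · subst h1 h2; refine ⟨by ring, by ring, rfl⟩
    rw [if_congr (h1 _ _ _ _ _ _ _) rfl rfl, if_congr (h2 _ _ _ _ _ _ _) rfl rfl,
      if_congr (h3 _ _ _ _ _ _ _) rfl rfl]
    by_cases hi : 2 * t.c - (2 * t.b - (2 * t.a - t.idx)) = u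
    · simp only [rev, hi, true_and, if_true]
    · simp [rev, hi]
  · rw [if_neg h, if_neg fun h' => h (hk.1 h'.1)]

theorem bdAt_rev (t : Term) (k : ℤ) (u p q : ZMod 7) :
    t.rev.bdAt k u p q = -t.bdAt (1 - k) (2 * q - (2 * p - u)) (2 * q - p) q := by
  have h := fAt_rev t.rev (1 - k) (2 * q - (2 * p - u)) (2 * q - p) q
  have e : 2 * q - (2 * (2 * q - p) - (2 * q - (2 * p - u))) = u := by ring
  rw [rev_rev, sub_sub_cancel, sub_sub_cancel, e] at h
  rw [bdAt, bdAt, ← h, fAt_rev]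
  ring

end Term

theorem IsCycle.rev {M : Multiset Term} (hM : IsCycle M) : IsCycle (M.map Term.rev) where
  good t ht := by
    obtain ⟨s, hs, rfl⟩ := Multiset.mem_map.1 ht
    exact (hM.good s hs).rev
  not_opp s hs t ht h := by
    obtain ⟨s, hs', rfl⟩ := Multiset.mem_map.1 hs
    obtain ⟨t, ht', rfl⟩ := Multiset.mem_map.1 ht
    have := h.rev
    rw [Term.rev_rev, Term.rev_rev] at this
    exact hM.not_opp s hs' t ht' this
  bd k u p q hpq := by
    have h := hM.bd (1 - k) (2 * q - (2 * p - u)) (2 * q - p) q fun h => hpq (by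
      revert h; revert p q; decide)
    rw [← neg_eq_zero, ← Multiset.sum_map_neg', Multiset.map_map] at h
    rw [Multiset.map_map, ← h]
    refine congrArg _ (Multiset.map_congr rfl fun t _ => ?_)
    rw [Function.comp_apply, Term.bdAt_rev, Function.comp_apply, ← mul_neg]
    rfl

theorem card_layer_rev (M : Multiset Term) (k : ℤ) :
    (layer (M.map Term.rev) k).card = (layer M (-k)).card := by
  rw [layer, Multiset.filter_map, Multiset.card_map, layer]
  refine congrArg _ (Multiset.filter_congr fun t _ => ?_)
  simp only [Function.comp_apply, Term.rev]
  omega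

theorem IsCycle.layer_card {M : Multiset Term} (hM : IsCycle M) (hl : M.card ≤ 7) {n N : ℤ}
    (hn : ∀ t ∈ M, n ≤ t.deg) (hN : ∀ t ∈ M, t.deg ≤ N) (hn0 : layer M n ≠ 0)
    (hN0 : layer M N ≠ 0) :
    (4 ≤ M.card ∧ (layer M n).card = M.card) ∨
    6 ≤ M.card ∧
      (((layer M n).card = 2 ∧ (layer M (n + 1)).card = M.card - 2) ∨
      ((layer M n).card = 3 ∧ (layer M (n + 1)).card = M.card - 3) ∨
      ((layer M N).card = 2 ∧ (layer M (N - 1)).card = M.card - 2) ∨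
      ((layer M N).card = 3 ∧ (layer M (N - 1)).card = M.card - 3)) := by
  have disj : ∀ i j : ℤ, i ≠ j → M.filter (fun t => t.deg = i ∧ t.deg = j) = 0 := fun i j hij =>
    Multiset.filter_eq_nil.2 fun t _ ht => hij (ht.1.symm.trans ht.2)
  have hbot : layer M (n - 1) = 0 := Multiset.filter_eq_nil.2 fun t ht h => by
    have := hn t ht; omega
  have htop : layer (M.map Term.rev) (-N - 1) = 0 := by
    rw [← Multiset.card_eq_zero, card_layer_rev, Multiset.card_eq_zero]
    exact Multiset.filter_eq_nil.2 fun t ht h => by have := hN t ht; omega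
  have hrev : ∀ k, (layer (M.map Term.rev) (-k)).card = (layer M k).card := fun k => by
    rw [card_layer_rev, neg_neg]
  have htop0 : layer (M.map Term.rev) (-N) ≠ 0 := by
    rwa [Ne, ← Multiset.card_eq_zero, hrev, Multiset.card_eq_zero]
  have a1 := hM.two_le_card_layer hbot hn0
  have a2 := hM.four_le_of_card_eq_two hbot
  have a3 := hM.two_le_of_card_eq_three hbot
  have b1 := hM.rev.two_le_card_layer htop htop0
  have b2 := hM.rev.four_le_of_card_eq_two htop
  have b3 := hM.rev.two_le_of_card_eq_three htop
  rw [show -N + 1 = -(N - 1) by ring] at b2 b3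
  rw [hrev] at b1 b2 b3
  rw [hrev] at b2 b3
  have two : ∀ i j : ℤ, i ≠ j → (layer M i).card + (layer M j).card ≤ M.card := fun i j hij =>
    card_filter_add_le fun t h1 h2 => hij (h1.symm.trans h2)
  have three : ∀ i j k : ℤ, i ≠ j → i ≠ k → j ≠ k →
      (layer M i).card + (layer M j).card + (layer M k).card ≤ M.card := by
    intro i j k hij hik hjk
    have h1 := card_filter_add_le (N := M) (P := fun t => t.deg = i ∨ t.deg = j)
      (Q := fun t => t.deg = k) (by omega)
    have h2 := Multiset.filter_add_filter (fun t : Term => t.deg = i) (fun t => t.deg = j) M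
    rw [disj i j hij, add_zero] at h2
    rw [← h2, Multiset.card_add] at h1
    exact h1
  have hnN : n ≤ N := by
    obtain ⟨t, ht⟩ := Multiset.exists_mem_of_ne_zero hn0
    have := Multiset.mem_of_mem_filter ht
    exact (hn t this).trans (hN t this)
  rcases hnN.eq_or_lt with rfl | hlt
  · have e : layer M n = M := Multiset.filter_eq_self.2 fun t ht =>
      le_antisymm (hN t ht) (hn t ht)
    have e1 : layer M (n + 1) = 0 := Multiset.filter_eq_nil.2 fun t ht h => by
      have := hN t ht; omega
    rw [e1, Multiset.card_zero] at a2 a3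
    have e2 : (layer M n).card = M.card := by rw [e]
    omega
  right
  rcases (Int.add_one_le_iff.2 hlt).eq_or_lt with rfl | hlt'
  · have e : (layer M n).card + (layer M (n + 1)).card = M.card := by
      rw [layer, layer, ← Multiset.card_add, Multiset.filter_add_filter, disj _ _ (by omega), add_zero]
      refine congrArg _ (Multiset.filter_eq_self.2 fun t ht => ?_)
      have := hn t ht
      have := hN t ht
      omega
    rw [add_sub_cancel_right] at *
    omega
  · exfalso
    have h1 := three n (n + 1) N (by omega) (by omega) (by omega)
    have h2 := three n (N - 1) N (by omega) (by omega) (by omega)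
    omega

theorem chain'_pair {X : Type*} {p q : X} : List.Chain' (· ≠ ·) [p, q] ↔ p ≠ q := by
  change List.IsChain _ _ ↔ _
  simp

theorem chain'_triple {X : Type*} {a b c : X} :
    List.Chain' (· ≠ ·) [a, b, c] ↔ a ≠ b ∧ b ≠ c := by
  change List.IsChain _ _ ↔ _
  simp

/-- The signed term underlying a generating triple. -/
def Term.ofGen (s : ℤ) (t : Gen (ZMod 7) (ℤ × ZMod 7)) : Term :=
  ⟨s, t.1.1.1, t.1.1.2, t.1.2.getD 0 0, t.1.2.getD 1 0, t.1.2.getD 2 0⟩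

/-- The multiset of signed terms of a chain, with multiplicities. -/
noncomputable def terms (γ : Ch (ZMod 7) (ℤ × ZMod 7)) : Multiset Term :=
  γ.sum fun t c => Multiset.replicate c.natAbs (Term.ofGen c.sign t)

theorem mem_terms {γ : Ch (ZMod 7) (ℤ × ZMod 7)} {x : Term} :
    x ∈ terms γ ↔ ∃ t ∈ γ.support, x = Term.ofGen (γ t).sign t := by
  rw [terms, Finsupp.sum, Multiset.mem_sum]
  refine exists_congr fun t => and_congr_right fun ht => ?_
  rw [Multiset.mem_replicate, and_iff_right]
  exact Int.natAbs_ne_zero.2 (Finsupp.mem_support_iff.1 ht)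

theorem map_terms {A : Type*} [AddCommMonoid A] (φ : Multiset Term →+ A)
    (γ : Ch (ZMod 7) (ℤ × ZMod 7)) :
    φ (terms γ) = γ.sum fun t c => c.natAbs • φ {Term.ofGen c.sign t} := by
  rw [terms, Finsupp.sum, map_sum]
  refine Finset.sum_congr rfl fun t _ => ?_
  rw [← Multiset.nsmul_singleton, map_nsmul]

theorem card_terms (γ : Ch (ZMod 7) (ℤ × ZMod 7)) : (terms γ).card = chainLen γ := by
  have e := map_terms Multiset.cardHom γ
  simpa [chainLen] using e

theorem card_layer_terms (γ : Ch (ZMod 7) (ℤ × ZMod 7)) (k : ℤ) :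
    (layer (terms γ) k).card = Tcount γ k := by
  rw [layer, ← Multiset.countP_eq_card_filter]
  refine (map_terms (Multiset.countPAddMonoidHom fun t : Term => t.deg = k) γ).trans ?_
  refine Finset.sum_congr rfl fun t _ => ?_
  change (γ t).natAbs • Multiset.countP (fun t : Term => t.deg = k) (Term.ofGen _ t ::ₘ 0) = _
  rw [Multiset.countP_cons]
  simp [Term.ofGen]

theorem sum_map_terms (γ : Ch (ZMod 7) (ℤ × ZMod 7)) (h : Term → ℤ) :
    ((terms γ).map h).sum =
      γ.sum fun t c => (c.natAbs : ℤ) * h (Term.ofGen c.sign t) := by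
  have e := map_terms (Multiset.sumAddMonoidHom.comp (Multiset.mapAddMonoidHom h)) γ
  simpa using e

theorem gen_of_chain' {X S : Type*} (s : S) {l : List X} (h : List.Chain' (· ≠ ·) l) :
    (gen s l : Ch X S) = Finsupp.single ⟨(s, l), h⟩ 1 :=
  dif_pos h

theorem gen_pair_apply {X S : Type*} [DecidableEq X] [DecidableEq S] (s s' : S) (x y p q : X)
    (h : List.Chain' (· ≠ ·) [p, q]) :
    (gen s [x, y] : Ch X S) ⟨(s', [p, q]), h⟩ = if s = s' ∧ x = p ∧ y = q then 1 else 0 := by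
  rw [gen]
  split_ifs with h1 h2 h2
  · obtain ⟨rfl, rfl, rfl⟩ := h2
    exact Finsupp.single_eq_same
  · refine Finsupp.single_eq_of_ne fun e => h2 ?_
    replace e := congrArg Subtype.val e
    simp only [Prod.mk.injEq, List.cons.injEq, and_true] at e
    exact ⟨e.1.symm, e.2.1.symm, e.2.2.symm⟩
  · obtain ⟨rfl, rfl, rfl⟩ := h2
    exact absurd h h1
  · rfl

theorem fOn_triple {X S : Type*} (s : S) (a b c : X) (h : List.Chain' (· ≠ ·) [a, b, c]) :
    fOn (⟨(s, [a, b, c]), h⟩ : Gen X S) = -gen s [b, c] + gen s [a, c] - gen s [a, b] := by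
  change ∑ j : Fin 3, _ = _
  rw [Fin.sum_univ_three]
  simp [sub_eq_add_neg]

theorem gOn_triple {X S : Type*} (op : X → X → X) (sact : S → X → S) (s : S) (a b c : X)
    (h : List.Chain' (· ≠ ·) [a, b, c]) :
    gOn op sact (⟨(s, [a, b, c]), h⟩ : Gen X S) =
      gen (sact s a) [b, c] - gen (sact s b) [op a b, c] + gen (sact s c) [op a c, op b c] := by
  change ∑ j : Fin 3, _ = _
  rw [Fin.sum_univ_three]
  simp [sub_eq_add_neg]

theorem bdAt_ofGen (s : ℤ) (t : Gen (ZMod 7) (ℤ × ZMod 7)) (ht : t.1.2.length = 3) (k : ℤ)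
    (u p q : ZMod 7) (h : List.Chain' (· ≠ ·) [p, q]) :
    (Term.ofGen s t).bdAt k u p q = fOn t ⟨((k, u), [p, q]), h⟩ +
      gOn R7op (zact R7op) t ⟨((k, u), [p, q]), h⟩ := by
  obtain ⟨⟨⟨n, v⟩, l⟩, hl⟩ := t
  obtain ⟨a, b, c, rfl⟩ := List.length_eq_three.1 ht
  rw [fOn_triple, gOn_triple]
  simp only [Finsupp.add_apply, Finsupp.sub_apply, Finsupp.neg_apply, gen_pair_apply,
    Term.bdAt, Term.gAt, Term.fAt, Term.ofGen, zact, R7op, Prod.mk.injEq,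
    List.getD_cons_zero, List.getD_cons_succ, and_assoc, ite_and]
  generalize n + 1 = m
  by_cases h1 : m = k <;> by_cases h2 : n = k <;> by_cases h3 : v = u <;>
    simp only [h1, h2, h3, if_true, if_false] <;> ring

theorem bd_apply {X S : Type*} (op : X → X → X) (sact : S → X → S) (γ : Ch X S) (x : Gen X S) :
    bd op sact γ x = γ.sum fun t c => c * (fOn t x + gOn op sact t x) := by
  simp only [bd, fmap, gmap, Finsupp.add_apply, Finsupp.sum, Finsupp.finsetSum_apply,
    Finsupp.smul_apply, smul_eq_mul, mul_add, Finset.sum_add_distrib]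

theorem ofGen_injective {s s' : ℤ} {t t' : Gen (ZMod 7) (ℤ × ZMod 7)} (ht : t.1.2.length = 3)
    (ht' : t'.1.2.length = 3) (hd : t.1.1.1 = t'.1.1.1) (hi : t.1.1.2 = t'.1.1.2)
    (ha : (Term.ofGen s t).a = (Term.ofGen s' t').a)
    (hb : (Term.ofGen s t).b = (Term.ofGen s' t').b)
    (hc : (Term.ofGen s t).c = (Term.ofGen s' t').c) : t = t' := by
  obtain ⟨⟨⟨n, v⟩, l⟩, hl⟩ := t
  obtain ⟨a, b, c, rfl⟩ := List.length_eq_three.1 ht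
  obtain ⟨⟨⟨n', v'⟩, l'⟩, hl'⟩ := t'
  obtain ⟨a', b', c', rfl⟩ := List.length_eq_three.1 ht'
  simp only [Term.ofGen, List.getD_cons_zero, List.getD_cons_succ] at *
  subst hd hi ha hb hc
  rfl

theorem isCycle_terms {γ : Ch (ZMod 7) (ℤ × ZMod 7)} (h3 : IsMChain 3 γ)
    (hcyc : bd R7op (zact R7op) γ = 0) : IsCycle (terms γ) where
  good x hx := by
    obtain ⟨t, ht, rfl⟩ := mem_terms.1 hx
    have hl := h3 t ht
    have hs : (γ t).sign = 1 ∨ (γ t).sign = -1 := by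
      rcases lt_or_gt_of_ne (Finsupp.mem_support_iff.1 ht) with h | h
      · exact Or.inr (Int.sign_eq_neg_one_of_neg h)
      · exact Or.inl (Int.sign_eq_one_of_pos h)
    generalize (γ t).sign = s at hs
    obtain ⟨⟨⟨n, v⟩, l⟩, hc⟩ := t
    obtain ⟨a, b, c, rfl⟩ := List.length_eq_three.1 hl
    exact ⟨hs, (chain'_triple.1 hc).1, (chain'_triple.1 hc).2⟩
  not_opp x hx y hy h := by
    obtain ⟨t, ht, rfl⟩ := mem_terms.1 hx
    obtain ⟨t', ht', rfl⟩ := mem_terms.1 hy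
    obtain ⟨h1, h2, h4, h5, h6, h7⟩ := h
    obtain rfl := ofGen_injective (h3 t ht) (h3 t' ht') h1 h2 h4 h5 h6
    have h8 : (γ t).sign = 0 := self_eq_neg.1 h7
    exact Finsupp.mem_support_iff.1 ht (Int.sign_eq_zero_iff_zero.1 h8)
  bd k u p q hpq := by
    have hc : List.Chain' (· ≠ ·) [p, q] := chain'_pair.2 hpq
    have h := bd_apply R7op (zact R7op) γ ⟨((k, u), [p, q]), hc⟩
    rw [hcyc, Finsupp.zero_apply] at h
    rw [sum_map_terms, h]
    refine Finset.sum_congr rfl fun t ht => ?_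
    simp only [bdAt_ofGen _ t (h3 t ht) k u p q hc]
    rw [← mul_assoc]
    congr 1
    rw [mul_comm]
    exact Int.sign_mul_natAbs _

/-- Reversal of generating triples. -/
def revGen : Gen (ZMod 7) (ℤ × ZMod 7) → Gen (ZMod 7) (ℤ × ZMod 7)
  | ⟨((n, u), [a, b, c]), h⟩ =>
    ⟨((-n, 2 * c - (2 * b - (2 * a - u))), [2 * c - (2 * b - a), 2 * c - b, c]), by
      obtain ⟨hab, hbc⟩ := chain'_triple.1 h
      exact chain'_triple.2 ⟨fun e => hab (by linear_combination e),
        fun e => hbc (by linear_combination -e)⟩⟩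
  | t => t

theorem revGen_involutive : Function.Involutive revGen := by
  rintro ⟨⟨⟨n, u⟩, l⟩, h⟩
  match l, h with
  | [a, b, c], h =>
    refine Subtype.ext (Prod.ext (Prod.ext ?_ ?_) ?_)
    · exact neg_neg n
    · simp only [revGen]; ring
    · simp only [revGen, List.cons.injEq, and_true]
      constructor <;> ring
  | [], h => rfl
  | [a], h => rfl
  | [a, b], h => rfl
  | a :: b :: c :: d :: l, h => rfl

theorem revGen_deg {t : Gen (ZMod 7) (ℤ × ZMod 7)} (ht : t.1.2.length = 3) :
    (revGen t).1.1.1 = -t.1.1.1 := by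
  obtain ⟨⟨⟨n, v⟩, l⟩, hc⟩ := t
  obtain ⟨a, b, c, rfl⟩ := List.length_eq_three.1 ht
  rfl

theorem reverse_eq_mapDomain {γ : Ch (ZMod 7) (ℤ × ZMod 7)} (h3 : IsMChain 3 γ) :
    reverse R7op γ = γ.mapDomain revGen := by
  refine Finset.sum_congr rfl fun t ht => ?_
  have hl := h3 t ht
  generalize γ t = z
  obtain ⟨⟨⟨n, v⟩, l⟩, hc⟩ := t
  obtain ⟨a, b, c, rfl⟩ := List.length_eq_three.1 hl
  change z • gen (revGen ⟨((n, v), [a, b, c]), hc⟩).1.1 (revGen ⟨((n, v), [a, b, c]), hc⟩).1.2 =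
    Finsupp.single (revGen ⟨((n, v), [a, b, c]), hc⟩) z
  rw [gen_of_chain' _ (revGen ⟨((n, v), [a, b, c]), hc⟩).2, Finsupp.smul_single, smul_eq_mul,
    mul_one]

theorem Tcount_reverse {γ : Ch (ZMod 7) (ℤ × ZMod 7)} (h3 : IsMChain 3 γ) (k : ℤ) :
    Tcount (reverse R7op γ) k = Tcount γ (-k) := by
  rw [reverse_eq_mapDomain h3, Tcount, Finsupp.sum_mapDomain_index_inj revGen_involutive.injective]
  refine Finset.sum_congr rfl fun t ht => ?_
  simp only [revGen_deg (h3 t ht), neg_eq_iff_eq_neg]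

theorem minDegree_reverse {γ : Ch (ZMod 7) (ℤ × ZMod 7)} (h3 : IsMChain 3 γ) {N : ℤ}
    (hN : ∃ t ∈ γ.support, t.1.1.1 = N) (hN' : ∀ t ∈ γ.support, t.1.1.1 ≤ N) :
    MinDegree (reverse R7op γ) (-N) := by
  rw [MinDegree, reverse_eq_mapDomain h3,
    Finsupp.mapDomain_support_of_injective revGen_involutive.injective]
  simp only [Finset.mem_image]
  refine ⟨?_, ?_⟩
  · obtain ⟨t, ht, rfl⟩ := hN
    exact ⟨_, ⟨t, ht, rfl⟩, revGen_deg (h3 t ht)⟩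
  · rintro _ ⟨t, ht, rfl⟩
    rw [revGen_deg (h3 t ht)]
    exact neg_le_neg (hN' t ht)

/-- shape of short 3-cycles of `(R₇, ℤ × R₇)`, up to reverse. -/
theorem cycle_shape_R7 (γ : Ch (ZMod 7) (ℤ × ZMod 7))
    (h3 : IsMChain 3 γ) (hcyc : bd R7op (zact R7op) γ = 0)
    (hl1 : 1 ≤ chainLen γ) (hl7 : chainLen γ ≤ 7) :
    (∃ n, MinDegree γ n ∧ Shape γ n (chainLen γ)) ∨
    (∃ n, MinDegree (reverse R7op γ) n ∧ Shape (reverse R7op γ) n (chainLen γ)) := by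
  have hne : γ.support.Nonempty := by
    rw [Finsupp.support_nonempty_iff]
    rintro rfl
    simp [chainLen] at hl1
  obtain ⟨t, ht, htmin⟩ := γ.support.exists_min_image (fun t => t.1.1.1) hne
  obtain ⟨t', ht', htmax⟩ := γ.support.exists_max_image (fun t => t.1.1.1) hne
  have hlayer : ∀ x ∈ γ.support, layer (terms γ) x.1.1.1 ≠ 0 := fun x hx h =>
    Multiset.filter_eq_nil.1 h _ (mem_terms.2 ⟨x, hx, rfl⟩) rfl
  have key := (isCycle_terms h3 hcyc).layer_card (n := t.1.1.1) (N := t'.1.1.1)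
    (by rwa [card_terms])
    (fun x hx => by obtain ⟨y, hy, rfl⟩ := mem_terms.1 hx; exact htmin y hy)
    (fun x hx => by obtain ⟨y, hy, rfl⟩ := mem_terms.1 hx; exact htmax y hy)
    (hlayer t ht) (hlayer t' ht')
  simp only [card_layer_terms, card_terms] at key
  have hmin : MinDegree γ t.1.1.1 := ⟨⟨t, ht, rfl⟩, htmin⟩
  have hmax := minDegree_reverse h3 ⟨t', ht', rfl⟩ htmax
  rcases key with ⟨h4, h⟩ | ⟨h6, h | h | h | h⟩
  · exact Or.inl ⟨_, hmin, Or.inl ⟨h4, hl7, h⟩⟩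
  · exact Or.inl ⟨_, hmin, Or.inr (Or.inl ⟨h6, hl7, h⟩)⟩
  · exact Or.inl ⟨_, hmin, Or.inr (Or.inr ⟨h6, hl7, h⟩)⟩
  · refine Or.inr ⟨_, hmax, Or.inr (Or.inl ⟨h6, hl7, ?_⟩)⟩
    rwa [Tcount_reverse h3, Tcount_reverse h3, neg_neg, neg_add, neg_neg, ← sub_eq_add_neg]
  · refine Or.inr ⟨_, hmax, Or.inr (Or.inr ⟨h6, hl7, ?_⟩)⟩
    rwa [Tcount_reverse h3, Tcount_reverse h3, neg_neg, neg_add, neg_neg, ← sub_eq_add_neg]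

end QHom
end

section
/- Let φ : O₆ → O₆ be any composition of the right-translation maps x ↦ x^b (b ∈ O₆) and their inverses. If γ = Σ_{i=1}^k ε_i (a_i, b_i, c_i) is a 3-cycle of C₃(O₆) (ε_i = ±1), then Σ_{i=1}^k ε_i η(φ(a_i), φ(b_i), φ(c_i)) = Σ_{i=1}^k ε_i η(a_i, b_i, c_i) in ℤ/3ℤ. In particular, if γ = Σ ε_i (ω_{a_i}, ω_{b_i}, ω_{c_i}) is a 3-cycle of O₆ where ω_j = φ(j), then η(γ) = Σ ε_i η(a_i, b_i, c_i). -/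
namespace QHom

variable {X S : Type*}

theorem octAct_bij : ∀ b : Fin 6, Function.Bijective fun a => octAct a b := by decide

/-- The right-translation `x ↦ x^b` of `O₆` as a permutation. -/
noncomputable def octPerm (b : Fin 6) : Equiv.Perm (Fin 6) :=
  Equiv.ofBijective (fun a => octAct a b) (octAct_bij b)

/-- The evaluation of a cochain on chains, as a linear map. -/
noncomputable def evalLin {A : Type*} [AddCommGroup A] (θ : List X → A) : Ch X S →ₗ[ℤ] A :=
  Finsupp.linearCombination ℤ fun t => θ t.1.2

theorem evalLin_gen {A : Type*} [AddCommGroup A] (θ : List X → A)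
    (hθ : ∀ l : List X, ¬ l.IsChain (· ≠ ·) → θ l = 0) (s : S) (l : List X) :
    evalLin θ (gen s l) = θ l := by
  unfold gen
  split_ifs with h
  · simp [evalLin]
  · rw [map_zero, hθ l h]

/-- The 2-cochain with values `ψ`, extended by zero to tuples of other lengths. -/
def cochain2 {A : Type*} [Zero A] (ψ : X → X → A) : List X → A
  | [a, b] => ψ a b
  | _ => 0

theorem cochain2_eq_zero {A : Type*} [Zero A] {ψ : X → X → A} (hψ : ∀ a, ψ a a = 0)
    (l : List X) (hl : ¬ l.IsChain (· ≠ ·)) : cochain2 ψ l = 0 := by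
  match l with
  | [] | [_] | _ :: _ :: _ :: _ => rfl
  | [a, b] =>
    have hab : a = b := by simpa using hl
    rw [hab]
    exact hψ b

/-- The coboundary of a 2-cochain of the quandle. -/
def coboundary2 {A : Type*} [AddCommGroup A] (op : X → X → X) (ψ : X → X → A) (a b c : X) : A :=
  -ψ b c + ψ a c - ψ a b + (ψ b c - ψ (op a b) c + ψ (op a c) (op b c))

theorem evalLin_bd {A : Type*} [AddCommGroup A] (op : X → X → X) (sact : S → X → S)
    {ψ : X → X → A} (hψ : ∀ a, ψ a a = 0) {θ : List X → A}
    (hθ : ∀ a b c, θ [a, b, c] = coboundary2 op ψ a b c) {γ : Ch X S} (h3 : IsMChain 3 γ) :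
    evalLin (cochain2 ψ) (bd op sact γ) = γ.sum fun t c => c • θ t.1.2 := by
  rw [bd, fmap, gmap, map_add, map_finsuppSum, map_finsuppSum, ← Finsupp.sum_add]
  refine Finsupp.sum_congr fun t ht => ?_
  have hlen := h3 t ht
  obtain ⟨⟨s, l⟩, h⟩ := t
  obtain ⟨a, b, c, rfl⟩ := List.length_eq_three.mp hlen
  have hgen := fun s l => evalLin_gen (S := S) (cochain2 ψ) (cochain2_eq_zero hψ) s l
  rw [map_smul, map_smul, ← smul_add]
  congr 1
  simp only [fOn, gOn, map_sum, map_smul, hgen, List.length_cons, List.length_nil, hθ,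
    coboundary2]
  simp [Fin.sum_univ_succ, cochain2]
  abel

theorem sum_smul_eq_zero_of_coboundary {A : Type*} [AddCommGroup A] (op : X → X → X)
    (sact : S → X → S) {ψ : X → X → A} (hψ : ∀ a, ψ a a = 0) {θ : List X → A}
    (hθ : ∀ a b c, θ [a, b, c] = coboundary2 op ψ a b c) {γ : Ch X S} (h3 : IsMChain 3 γ)
    (hcyc : bd op sact γ = 0) : (γ.sum fun t c => c • θ t.1.2) = 0 := by
  rw [← evalLin_bd op sact hψ hθ h3, hcyc, map_zero]

/-- The permutations `φ` that are automorphisms of `op` and for which `φ^* f` is cohomologous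
to the 3-cochain `f`. -/
def cohomologousStabilizer {A : Type*} [AddCommGroup A] (op : X → X → X) (f : X → X → X → A) :
    Subgroup (Equiv.Perm X) where
  carrier := {φ | (∀ a b, φ (op a b) = op (φ a) (φ b)) ∧ ∃ ψ : X → X → A, (∀ a, ψ a a = 0) ∧
    ∀ a b c, f (φ a) (φ b) (φ c) - f a b c = coboundary2 op ψ a b c}
  one_mem' := ⟨fun _ _ => rfl, 0, fun _ => rfl, fun a b c => by simp [coboundary2]⟩
  mul_mem' := by
    rintro φ χ ⟨hφ, ψ, hψ, h⟩ ⟨hχ, ψ', hψ', h'⟩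
    refine ⟨fun a b => by simp [hφ, hχ], fun a b => ψ (χ a) (χ b) + ψ' a b,
      fun a => by simp [hψ, hψ'], fun a b c => ?_⟩
    have e := h (χ a) (χ b) (χ c)
    have e' := h' a b c
    simp only [Equiv.Perm.mul_apply]
    rw [← sub_add_sub_cancel _ (f (χ a) (χ b) (χ c)), e, e']
    simp only [coboundary2, hχ]
    abel
  inv_mem' := by
    rintro φ ⟨hφ, ψ, hψ, h⟩
    have hinv : ∀ a b, φ⁻¹ (op a b) = op (φ⁻¹ a) (φ⁻¹ b) := fun a b => by
      rw [Equiv.Perm.inv_eq_iff_eq, hφ]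
      simp
    refine ⟨hinv, fun a b => -ψ (φ⁻¹ a) (φ⁻¹ b), fun a => by simp [hψ], fun a b c => ?_⟩
    have e := h (φ⁻¹ a) (φ⁻¹ b) (φ⁻¹ c)
    simp only [← Equiv.Perm.mul_apply, mul_inv_cancel, Equiv.Perm.one_apply] at e
    rw [← neg_sub, e]
    simp only [coboundary2, hinv]
    abel

theorem sig0_iterate_mod (k : ℕ) : sig0^[k] = sig0^[k % 4] := by
  have h4 : sig0^[4] = id := by decide
  conv_lhs => rw [← Nat.mod_add_div k 4, Function.iterate_add, Function.iterate_mul, h4,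
    Function.iterate_id, Function.comp_id]

/-- The triple `(a, b, c)` is a translate of an element of `L` by one of the first four powers
of `σ₀`. -/
abbrev InOrbit (L : List (Fin 6 × Fin 6 × Fin 6)) (a b c : Fin 6) : Prop :=
  ∃ k : Fin 4, ∃ p ∈ L,
    a = sig0^[(k : ℕ)] p.1 ∧ b = sig0^[(k : ℕ)] p.2.1 ∧ c = sig0^[(k : ℕ)] p.2.2

theorem exists_iterate_iff_inOrbit (L : List (Fin 6 × Fin 6 × Fin 6)) (a b c : Fin 6) :
    (∃ k : ℕ, ∃ p ∈ L, a = sig0^[k] p.1 ∧ b = sig0^[k] p.2.1 ∧ c = sig0^[k] p.2.2) ↔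
      InOrbit L a b c := by
  constructor
  · rintro ⟨k, p, hp, h⟩
    rw [sig0_iterate_mod k] at h
    exact ⟨⟨k % 4, Nat.mod_lt _ (by norm_num)⟩, p, hp, h⟩
  · rintro ⟨k, p, hp, h⟩
    exact ⟨k, p, hp, h⟩

theorem etaFun_eq (a b c : Fin 6) :
    etaFun a b c =
      if InOrbit etaTriples1 a b c then 1 else if InOrbit etaTriples2 a b c then 2 else 0 := by
  simp only [etaFun, exists_iterate_iff_inOrbit]

theorem octAct_dist : ∀ a b c : Fin 6,
    octAct (octAct a b) c = octAct (octAct a c) (octAct b c) := by decide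

/-- A 2-cochain whose coboundary is `σ₁^* η - η`. -/
def etaPotential (a b : Fin 6) : ZMod 3 :=
  ![![0, 0, 2, 1, 1, 2],
    ![0, 0, 2, 2, 0, 2],
    ![2, 2, 0, 2, 2, 2],
    ![2, 1, 2, 0, 0, 2],
    ![2, 0, 2, 0, 0, 2],
    ![0, 0, 1, 0, 0, 0]] a b

theorem octPerm_zero_mem : octPerm 0 ∈ cohomologousStabilizer octAct etaFun := by
  refine ⟨fun a b => octAct_dist a b 0, 0, fun _ => rfl, fun a b c => ?_⟩
  change etaFun (octAct a 0) (octAct b 0) (octAct c 0) - etaFun a b c = _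
  simp only [etaFun_eq]
  revert a b c
  decide +kernel

theorem octPerm_one_mem : octPerm 1 ∈ cohomologousStabilizer octAct etaFun := by
  refine ⟨fun a b => octAct_dist a b 1, etaPotential, by decide, fun a b c => ?_⟩
  change etaFun (octAct a 1) (octAct b 1) (octAct c 1) - etaFun a b c = _
  simp only [etaFun_eq]
  revert a b c
  decide +kernel

theorem octPerm_octAct (a b : Fin 6) :
    octPerm (octAct a b) = octPerm b * octPerm a * (octPerm b)⁻¹ := by
  rw [eq_mul_inv_iff_mul_eq]
  ext1 x
  exact (octAct_dist x a b).symm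

theorem octPerm_mem (b : Fin 6) : octPerm b ∈ cohomologousStabilizer octAct etaFun := by
  have conj {a b : Fin 6} (ha : octPerm a ∈ cohomologousStabilizer octAct etaFun)
      (hb : octPerm b ∈ cohomologousStabilizer octAct etaFun) :
      octPerm (octAct a b) ∈ cohomologousStabilizer octAct etaFun := by
    rw [octPerm_octAct]
    exact mul_mem (mul_mem hb ha) (inv_mem hb)
  have h0 := octPerm_zero_mem
  have h1 := octPerm_one_mem
  have h2 : octPerm 2 ∈ _ := conj h1 h0
  have h4 : octPerm 4 ∈ _ := conj h2 h0
  have h5 : octPerm 5 ∈ _ := conj h4 h0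
  have h3 : octPerm 3 ∈ _ := conj h5 h1
  fin_cases b <;> assumption

/-- the weight of a 3-cycle of `C₃(O₆)` with respect to `η` is invariant
under any composition `φ` of the right translations and their inverses. -/
theorem eta_weight_invariant (φ : Equiv.Perm (Fin 6))
    (hφ : φ ∈ Subgroup.closure (Set.range octPerm))
    (γ : Ch (Fin 6) Unit) (h3 : IsMChain 3 γ)
    (hcyc : bd octAct (fun s _ => s) γ = 0) :
    (γ.sum fun t c => c • etaL (t.1.2.map fun x => φ x)) =
      γ.sum fun t c => c • etaL t.1.2 := by
  have hmem : φ ∈ cohomologousStabilizer octAct etaFun := by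
    refine (Subgroup.closure_le _).mpr ?_ hφ
    rintro _ ⟨b, rfl⟩
    exact octPerm_mem b
  obtain ⟨-, ψ, hψ, h⟩ := hmem
  have hzero := sum_smul_eq_zero_of_coboundary octAct (fun s _ => s) hψ
    (θ := fun l => etaL (l.map fun x => φ x) - etaL l) h h3 hcyc
  simp only [smul_sub, Finsupp.sum_sub] at hzero
  exact sub_eq_zero.mp hzero

end QHom
end
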